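/- arXiv:2509.02832 — 2 statements merged into one kernel-verified Lean document; each statement's English description precedes it below -/
import Mathlib

section
/- For every fixed r there exists N = N(r) such that for every n ≥ N, every matroid M of rank r on a ground set of size n, and every pair of circuits C, C' of M with |C| > |C'|, one has β_C < β_{C'} (i.e., monotonicity holds for M). -/
open Finset

/-- A matroid presented by its collection of circuits (the valid sets of bingo
cards): nonempty ground set axioms (C1)-(C3) of the paper. -/
structure BingoMatroid (α : Type*) [DecidableEq α] where
  /-- the ground set -/
  E : Finset α
  /-- the circuits (bingo cards) -/
  circuits : Finset (Finset α)
  subset_ground : ∀ C ∈ circuits, C ⊆ E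
  empty_not_mem : ∅ ∉ circuits
  antichain : ∀ C₁ ∈ circuits, ∀ C₂ ∈ circuits, C₁ ⊆ C₂ → C₁ = C₂
  elimination : ∀ C₁ ∈ circuits, ∀ C₂ ∈ circuits, C₁ ≠ C₂ →
    ∀ e ∈ C₁ ∩ C₂, ∃ C₃ ∈ circuits, C₃ ⊆ (C₁ ∪ C₂) \ {e}

/-- The completion time `t_C(σ)`: the least `t` such that every element of `C`
has been called out among the first `t` values of `σ`. -/
noncomputable def hitTime {α : Type*} {n : ℕ} (σ : Fin n → α) (C : Finset α) : ℕ :=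
  sInf {t : ℕ | ∀ x ∈ C, ∃ i : Fin n, (i : ℕ) < t ∧ σ i = x}

namespace BingoMatroid

variable {α : Type*} [DecidableEq α]

/-- `C` wins the bingo game under calling order `σ`: it is completed strictly
before every other circuit. -/
def Wins (M : BingoMatroid α) (σ : Fin M.E.card ≃ {x // x ∈ M.E}) (C : Finset α) : Prop :=
  ∀ C' ∈ M.circuits, C' ≠ C →
    hitTime (fun i => (σ i : α)) C < hitTime (fun i => (σ i : α)) C'

/-- The winning probability `β_C`: the number of calling orders under which `C`
wins, divided by `n!`. -/
noncomputable def beta (M : BingoMatroid α) (C : Finset α) : ℚ :=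
  (Nat.card {σ : Fin M.E.card ≃ {x // x ∈ M.E} // M.Wins σ C} : ℚ) /
    (Nat.factorial M.E.card : ℚ)

/-- The timed winning probability `β_C(t)`: the probability that `C` wins and is
completed exactly in round `t`. -/
noncomputable def betaT (M : BingoMatroid α) (C : Finset α) (t : ℕ) : ℚ :=
  (Nat.card {σ : Fin M.E.card ≃ {x // x ∈ M.E} //
      M.Wins σ C ∧ hitTime (fun i => (σ i : α)) C = t} : ℚ) /
    (Nat.factorial M.E.card : ℚ)

/-- A set is independent if it is contained in the ground set and contains no circuit. -/
def Indep (M : BingoMatroid α) (I : Finset α) : Prop :=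
  I ⊆ M.E ∧ ∀ C ∈ M.circuits, ¬ C ⊆ I

/-- The rank of the matroid: the maximum size of an independent set. -/
noncomputable def rank (M : BingoMatroid α) : ℕ :=
  sSup {k : ℕ | ∃ I : Finset α, M.Indep I ∧ I.card = k}

/-- A basis is a maximal independent set. -/
def IsBase (M : BingoMatroid α) (B : Finset α) : Prop :=
  M.Indep B ∧ ∀ J : Finset α, M.Indep J → B ⊆ J → B = J

/-- A coloop is an element of the ground set contained in no circuit. -/
def IsColoop (M : BingoMatroid α) (e : α) : Prop :=
  e ∈ M.E ∧ ∀ C ∈ M.circuits, e ∉ C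

/-- `D` is a circuit of the contraction `M/T`: a nonempty inclusion-minimal
member of `{C \ T : C a circuit of M}`. -/
def IsContractCircuit (M : BingoMatroid α) (T D : Finset α) : Prop :=
  D.Nonempty ∧ (∃ C ∈ M.circuits, D = C \ T) ∧
    ∀ C' ∈ M.circuits, (C' \ T).Nonempty → ¬ (C' \ T) ⊂ D

end BingoMatroid

universe u

section Counting

variable {ι β : Type*} [Fintype ι] [Fintype β] [DecidableEq ι] [DecidableEq β]

/-- The bijections `σ` under which `C` occupies exactly the positions in `K` are equally numerous
for all position sets `K` of the right size. -/
theorem card_filter_map_symm_eq_mul_choose (C : Finset β) (K : Finset ι) (hK : #K = #C)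
    (h : Fintype.card ι = Fintype.card β) :
    #{σ : ι ≃ β | C.map σ.symm.toEmbedding = K} * (Fintype.card ι).choose #C =
      (Fintype.card ι).factorial := by
  have hconst : ∀ L ∈ powersetCard #C (univ : Finset ι),
      #{σ : ι ≃ β | C.map σ.symm.toEmbedding = L} =
        #{σ : ι ≃ β | C.map σ.symm.toEmbedding = K} := by
    intro L hL
    have hLK : #L = #K := (mem_powersetCard.1 hL).2.trans hK.symm
    let τ : Equiv.Perm ι := (Finset.equivOfCardEq hLK).extendSubtype
    have hτ : L.map τ.toEmbedding = K := by
      refine eq_of_subset_of_card_le (fun x hx => ?_) (by simp [hLK])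
      obtain ⟨y, hy, rfl⟩ := mem_map.1 hx
      exact (Finset.equivOfCardEq hLK).extendSubtype_mem y hy
    refine card_equiv (Equiv.equivCongr τ (Equiv.refl β)) fun σ => ?_
    have hmap : C.map ((Equiv.equivCongr τ (Equiv.refl β)) σ).symm.toEmbedding =
        (C.map σ.symm.toEmbedding).map τ.toEmbedding := by
      rw [map_map]
      rfl
    simp only [mem_filter, mem_univ, true_and, hmap]
    rw [← hτ]
    exact (map_injective τ.toEmbedding).eq_iff.symm
  have hsum := card_eq_sum_card_fiberwise (s := (univ : Finset (ι ≃ β)))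
    (t := powersetCard #C (univ : Finset ι)) (f := fun σ => C.map σ.symm.toEmbedding)
    (fun σ _ => by simp)
  rw [sum_congr rfl hconst, sum_const, card_powersetCard, card_univ, card_univ,
    Fintype.card_equiv (Fintype.equivOfCardEq h), smul_eq_mul] at hsum
  rw [hsum, mul_comm]

end Counting

theorem hitTime_le_iff {α : Type*} {n : ℕ} {σ : Fin n → α} {C : Finset α}
    (hC : ∀ x ∈ C, ∃ i, σ i = x) (t : ℕ) :
    hitTime σ C ≤ t ↔ ∀ x ∈ C, ∃ i : Fin n, (i : ℕ) < t ∧ σ i = x := by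
  refine ⟨fun h x hx => ?_, fun h => Nat.sInf_le h⟩
  have hmem : hitTime σ C ∈ {t : ℕ | ∀ x ∈ C, ∃ i : Fin n, (i : ℕ) < t ∧ σ i = x} :=
    Nat.sInf_mem ⟨n, fun x hx => (hC x hx).imp fun i hi => ⟨i.2, hi⟩⟩
  obtain ⟨i, hi, rfl⟩ := hmem x hx
  exact ⟨i, hi.trans_le h, rfl⟩

theorem mul_choose_lt_choose {n k l b : ℕ} (hlk : l < k) (hn : k * b + 2 * k ≤ n) :
    b * n.choose l < n.choose k := by
  obtain ⟨m, rfl⟩ : ∃ m, k = m + 1 := ⟨k - 1, by omega⟩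
  have hle : n.choose l ≤ n.choose m := by
    refine Nat.le_induction (P := fun j _ => j ≤ m → n.choose l ≤ n.choose j) (fun _ => le_rfl)
      (fun j _ ih hj => (ih (by omega)).trans (Nat.choose_le_succ_of_lt_half_left ?_))
      m (by omega) le_rfl
    omega
  have hpos : 0 < n.choose m := Nat.choose_pos (by nlinarith)
  have hstep := Nat.choose_succ_right_eq n m
  have hlt : (m + 1) * b < n - m := by omega
  have : b * n.choose m < n.choose (m + 1) := by
    refine lt_of_mul_lt_mul_right (a := m + 1) ?_ (Nat.zero_le _)
    rw [hstep]
    calc b * n.choose m * (m + 1) = n.choose m * ((m + 1) * b) := by ring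
      _ < n.choose m * (n - m) := Nat.mul_lt_mul_of_pos_left hlt hpos
  exact (Nat.mul_le_mul_left b hle).trans_lt this

namespace BingoMatroid

variable {α : Type*} [DecidableEq α] (M : BingoMatroid α)

theorem card_le_rank {I : Finset α} (hI : M.Indep I) : #I ≤ M.rank :=
  le_csSup ⟨#M.E, by rintro _ ⟨J, hJ, rfl⟩; exact card_le_card hJ.1⟩ ⟨I, hI, rfl⟩

theorem card_le_rank_add_one {C : Finset α} (hC : C ∈ M.circuits) : #C ≤ M.rank + 1 := by
  obtain ⟨e, he⟩ : C.Nonempty :=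
    nonempty_iff_ne_empty.2 fun h => M.empty_not_mem (h ▸ hC)
  have hI : M.Indep (C.erase e) := by
    refine ⟨(erase_subset _ _).trans (M.subset_ground C hC), fun D hD hDC => ?_⟩
    obtain rfl := M.antichain D hD C hC (hDC.trans (erase_subset _ _))
    exact notMem_erase e D (hDC he)
  have := M.card_le_rank hI
  rw [card_erase_of_mem he] at this
  omega

variable {M}

theorem hitTime_le_iff_mem {C : Finset α} (hC : C ∈ M.circuits)
    (σ : Fin #M.E ≃ {x // x ∈ M.E}) (t : ℕ) :
    hitTime (fun i => (σ i : α)) C ≤ t ↔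
      (C.subtype (· ∈ M.E)).map σ.symm.toEmbedding ⊆ ({i | (i : ℕ) < t} : Finset (Fin #M.E)) := by
  rw [hitTime_le_iff fun x hx => ⟨σ.symm ⟨x, M.subset_ground C hC hx⟩, by simp⟩]
  constructor
  · intro h i hi
    obtain ⟨y, hy, rfl⟩ := mem_map.1 hi
    obtain ⟨j, hj, hjy⟩ := h y (mem_subtype.1 hy)
    have : σ j = y := Subtype.ext hjy
    simpa [← this] using hj
  · intro h x hx
    have hxE := M.subset_ground C hC hx
    refine ⟨σ.symm ⟨x, hxE⟩, ?_, by simp⟩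
    simpa using h (mem_map_of_mem _ (mem_subtype.2 hx : (⟨x, hxE⟩ : {x // x ∈ M.E}) ∈ _))

theorem card_subtype_ground {C : Finset α} (hC : C ∈ M.circuits) :
    #(C.subtype (· ∈ M.E)) = #C := by
  rw [card_subtype, filter_true_of_mem fun x hx => M.subset_ground C hC hx]

/-- Some circuit is completed within the first `rank + 1` calls. -/
theorem Wins.hitTime_le {C : Finset α} (hC : C ∈ M.circuits)
    {σ : Fin #M.E ≃ {x // x ∈ M.E}} (hσ : M.Wins σ C) (hr : M.rank < #M.E) :
    hitTime (fun i => (σ i : α)) C ≤ M.rank + 1 := by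
  by_contra! hlt
  let emb : Fin #M.E ↪ α := σ.toEmbedding.trans (Function.Embedding.subtype _)
  let S : Finset α := ({i | (i : ℕ) < M.rank + 1} : Finset (Fin #M.E)).map emb
  have hS : M.Indep S := by
    refine ⟨fun x hx => ?_, fun D hD hDS => ?_⟩
    · obtain ⟨i, -, rfl⟩ := mem_map.1 hx
      exact (σ i).2
    · have hle : hitTime (fun i => (σ i : α)) D ≤ M.rank + 1 := by
        refine Nat.sInf_le fun x hx => ?_
        obtain ⟨i, hi, rfl⟩ := mem_map.1 (hDS hx)
        exact ⟨i, (mem_filter.1 hi).2, rfl⟩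
      rcases eq_or_ne D C with rfl | hne
      · omega
      · have := hσ D hD hne
        omega
  have := M.card_le_rank hS
  rw [card_map, Fin.card_filter_val_lt] at this
  omega

theorem beta_mul_choose_le {C : Finset α} (hC : C ∈ M.circuits) (hr : M.rank < #M.E) :
    M.beta C * (#M.E).choose #C ≤ (M.rank + 1).choose #C := by
  classical
  set P : Finset (Fin #M.E) := {i | (i : ℕ) < M.rank + 1} with hP
  have hPcard : #P = M.rank + 1 := by rw [hP, Fin.card_filter_val_lt]; omega
  set D := C.subtype (· ∈ M.E) with hD
  have hDcard : #D = #C := card_subtype_ground hC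
  have hsub : ({σ | M.Wins σ C} : Finset (Fin #M.E ≃ {x // x ∈ M.E})) ⊆
      (powersetCard #C P).biUnion fun K => {σ | D.map σ.symm.toEmbedding = K} := by
    intro σ hσ
    have hle := ((mem_filter.1 hσ).2.hitTime_le hC hr)
    rw [hitTime_le_iff_mem hC] at hle
    simp only [mem_biUnion, mem_powersetCard, mem_filter, mem_univ, true_and]
    exact ⟨_, ⟨hle, by simp [← hDcard, hD]⟩, rfl⟩
  have hcount : #({σ | M.Wins σ C} : Finset (Fin #M.E ≃ {x // x ∈ M.E})) * (#M.E).choose #C ≤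
      (M.rank + 1).choose #C * (#M.E).factorial := by
    calc _ ≤ (∑ K ∈ powersetCard #C P,
          #{σ : Fin #M.E ≃ {x // x ∈ M.E} | D.map σ.symm.toEmbedding = K}) *
            (#M.E).choose #C :=
          Nat.mul_le_mul_right _ ((card_le_card hsub).trans card_biUnion_le)
      _ = ∑ K ∈ powersetCard #C P, (#M.E).factorial := by
          rw [sum_mul]
          refine sum_congr rfl fun K hK => ?_
          have := card_filter_map_symm_eq_mul_choose D K
            ((mem_powersetCard.1 hK).2.trans hDcard.symm) (by simp)
          rwa [hDcard, Fintype.card_fin] at this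
      _ = _ := by rw [sum_const, card_powersetCard, hPcard, smul_eq_mul]
  rw [beta, Nat.card_eq_fintype_card, Fintype.card_subtype, div_mul_eq_mul_div,
    div_le_iff₀ (by positivity)]
  exact_mod_cast hcount

theorem one_le_beta_mul_choose {C : Finset α} (hC : C ∈ M.circuits) :
    1 ≤ M.beta C * (#M.E).choose #C := by
  classical
  set P : Finset (Fin #M.E) := {i | (i : ℕ) < #C} with hP
  have hPcard : #P = #C := by
    rw [hP, Fin.card_filter_val_lt]
    exact min_eq_right (card_le_card (M.subset_ground C hC))
  set D := C.subtype (· ∈ M.E) with hD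
  have hDcard : #D = #C := card_subtype_ground hC
  have hsub : ({σ | D.map σ.symm.toEmbedding = P} : Finset (Fin #M.E ≃ {x // x ∈ M.E})) ⊆
      ({σ | M.Wins σ C} : Finset (Fin #M.E ≃ {x // x ∈ M.E})) := by
    intro σ hσ
    have hσP := (mem_filter.1 hσ).2
    refine mem_filter.2 ⟨mem_univ _, fun C' hC' hne => ?_⟩
    refine ((hitTime_le_iff_mem hC σ #C).2 hσP.subset).trans_lt ?_
    by_contra! hle
    rw [hitTime_le_iff_mem hC', ← hP, ← hσP, map_subset_map] at hle
    refine hne (M.antichain C' hC' C hC fun x hx => ?_)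
    exact mem_subtype.1 (hle (mem_subtype.2 hx :
      (⟨x, M.subset_ground C' hC' hx⟩ : {x // x ∈ M.E}) ∈ _))
  have hcount : (#M.E).factorial ≤
      #({σ | M.Wins σ C} : Finset (Fin #M.E ≃ {x // x ∈ M.E})) * (#M.E).choose #C := by
    have := card_filter_map_symm_eq_mul_choose D P (hPcard.trans hDcard.symm) (by simp)
    rw [hDcard, Fintype.card_fin] at this
    rw [← this]
    exact Nat.mul_le_mul_right _ (card_le_card hsub)
  rw [beta, Nat.card_eq_fintype_card, Fintype.card_subtype, div_mul_eq_mul_div,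
    le_div_iff₀ (by positivity), one_mul]
  exact_mod_cast hcount

end BingoMatroid

/-- for fixed rank `r`, monotonicity holds for every matroid of
rank `r` on sufficiently many elements. -/
theorem stmt10 (r : ℕ) :
    ∃ N : ℕ, ∀ (α : Type u) [DecidableEq α] (M : BingoMatroid α),
      M.rank = r → N ≤ M.E.card →
      ∀ C ∈ M.circuits, ∀ C' ∈ M.circuits, C'.card < C.card →
        M.beta C < M.beta C' := by
  refine ⟨(r + 1) * 2 ^ (r + 1) + 2 * (r + 1), ?_⟩
  rintro α _ M rfl hN C hC C' hC' hlt
  have hk := M.card_le_rank_add_one hC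
  have hupper := M.beta_mul_choose_le hC (by omega)
  have hlower := M.one_le_beta_mul_choose hC'
  have hchoose : (M.rank + 1).choose #C * (#M.E).choose #C' < (#M.E).choose #C := by
    refine mul_choose_lt_choose hlt (le_trans ?_ hN)
    gcongr
    exact Nat.choose_le_two_pow _ _
  have hchoose' : ((M.rank + 1).choose #C * (#M.E).choose #C' : ℚ) < (#M.E).choose #C := by
    exact_mod_cast hchoose
  have hpos : (0 : ℚ) < (#M.E).choose #C := by
    exact_mod_cast (Nat.zero_le _).trans_lt hchoose
  have hpos' : (0 : ℚ) < (#M.E).choose #C' := by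
    exact_mod_cast Nat.choose_pos (card_le_card (M.subset_ground C' hC'))
  calc M.beta C ≤ (M.rank + 1).choose #C / (#M.E).choose #C := (le_div_iff₀ hpos).2 hupper
    _ < 1 / (#M.E).choose #C' := by
      rw [div_lt_div_iff₀ hpos hpos', one_mul]
      exact hchoose'
    _ ≤ M.beta C' := (div_le_iff₀ hpos').2 hlower
end

section
/- Let M be a coloopless matroid of rank r on a finite ground set. Then for every k with 0 ≤ k ≤ r, the number of independent sets of M of cardinality k is at least binom(r+1, k). -/
open Finset

namespace BingoMatroid

variable {α : Type*} [DecidableEq α] {M : BingoMatroid α}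

theorem strong_elimination {C₁ C₂ : Finset α} {e f : α} (h₁ : C₁ ∈ M.circuits)
    (h₂ : C₂ ∈ M.circuits) (he₁ : e ∈ C₁) (he₂ : e ∈ C₂) (hf₁ : f ∈ C₁) (hf₂ : f ∉ C₂) :
    ∃ C ∈ M.circuits, C ⊆ (C₁ ∪ C₂).erase e ∧ f ∈ C := by
  induction hn : (C₁ ∪ C₂).card using Nat.strong_induction_on generalizing C₁ C₂ e f with
  | _ n ih =>
  subst hn
  obtain ⟨C₃, h₃, hC₃⟩ := M.elimination C₁ h₁ C₂ h₂ (fun h ↦ hf₂ (h ▸ hf₁)) e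
    (mem_inter.2 ⟨he₁, he₂⟩)
  rw [sdiff_singleton_eq_erase] at hC₃
  by_cases hf₃ : f ∈ C₃
  · exact ⟨C₃, h₃, hC₃, hf₃⟩
  obtain ⟨hC₃, he₃⟩ := subset_erase.1 hC₃
  obtain ⟨g, hg₃, hg₁⟩ := not_subset.1 fun h ↦ hf₃ (M.antichain C₃ h₃ C₁ h₁ h ▸ hf₁)
  have hg₂ : g ∈ C₂ := (mem_union.1 (hC₃ hg₃)).resolve_left hg₁
  have h₂₃ : C₂ ∪ C₃ ⊆ C₁ ∪ C₂ := union_subset subset_union_right hC₃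
  obtain ⟨C₄, h₄, hC₄, he₄⟩ := ih (C₂ ∪ C₃).card
    (card_lt_card ((ssubset_iff_of_subset h₂₃).2 ⟨f, by simp [hf₁], by simp [hf₂, hf₃]⟩))
    h₂ h₃ hg₂ hg₃ he₂ he₃ rfl
  obtain ⟨hC₄, hg₄⟩ := subset_erase.1 hC₄
  have hf₄ : f ∉ C₄ := fun h ↦ (mem_union.1 (hC₄ h)).elim hf₂ hf₃
  have h₁₄ : C₁ ∪ C₄ ⊆ C₁ ∪ C₂ := union_subset subset_union_left (hC₄.trans h₂₃)
  obtain ⟨C₅, h₅, hC₅, hf₅⟩ := ih (C₁ ∪ C₄).card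
    (card_lt_card ((ssubset_iff_of_subset h₁₄).2 ⟨g, by simp [hg₂], by simp [hg₁, hg₄]⟩))
    h₁ h₄ he₁ he₄ hf₁ hf₄ rfl
  exact ⟨C₅, h₅, hC₅.trans (erase_subset_erase e h₁₄), hf₅⟩

theorem Indep.mono {I J : Finset α} (hJ : M.Indep J) (h : I ⊆ J) : M.Indep I :=
  ⟨h.trans hJ.1, fun C hC hCI ↦ hJ.2 C hC (hCI.trans h)⟩

theorem bddAbove_card_indep (M : BingoMatroid α) :
    BddAbove {k : ℕ | ∃ I : Finset α, M.Indep I ∧ I.card = k} :=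
  ⟨M.E.card, by rintro _ ⟨I, hI, rfl⟩; exact card_le_card hI.1⟩

theorem exists_isBase_card_eq_rank (M : BingoMatroid α) :
    ∃ B, M.IsBase B ∧ B.card = M.rank := by
  have hne : {k : ℕ | ∃ I : Finset α, M.Indep I ∧ I.card = k}.Nonempty :=
    ⟨0, ∅, ⟨empty_subset _, fun C hC h ↦
      M.empty_not_mem (subset_empty.1 h ▸ hC)⟩, card_empty⟩
  obtain ⟨B, hB, hcard⟩ := Nat.sSup_mem hne M.bddAbove_card_indep
  refine ⟨B, ⟨hB, fun J hJ hBJ ↦ eq_of_subset_of_card_le hBJ ?_⟩, hcard⟩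
  rw [hcard]
  exact le_csSup M.bddAbove_card_indep ⟨J, hJ, rfl⟩

theorem IsBase.exists_circuit_subset_insert {B : Finset α} {e : α} (hB : M.IsBase B)
    (he : e ∈ M.E) (heB : e ∉ B) : ∃ D ∈ M.circuits, D ⊆ insert e B ∧ e ∈ D := by
  by_contra! h
  have hind : M.Indep (insert e B) := by
    refine ⟨insert_subset he hB.1.1, fun D hD hDB ↦ hB.1.2 D hD ?_⟩
    have := h D hD hDB
    grind
  exact heB (hB.2 _ hind (subset_insert e B) ▸ mem_insert_self e B)

/-- An element of a base lying in some circuit lies in a fundamental circuit of that base. -/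
theorem IsBase.exists_fundamental_circuit {B C : Finset α} {b : α} (hB : M.IsBase B)
    (hC : C ∈ M.circuits) (hbC : b ∈ C) :
    ∃ e ∈ M.E, e ∉ B ∧ ∃ D ∈ M.circuits, D ⊆ insert e B ∧ e ∈ D ∧ b ∈ D := by
  induction hn : (C \ B).card using Nat.strong_induction_on generalizing C with
  | _ n ih =>
  subst hn
  obtain ⟨e, heC, heB⟩ := not_subset.1 (hB.1.2 C hC)
  have heE := M.subset_ground C hC heC
  obtain ⟨D, hD, hDB, heD⟩ := hB.exists_circuit_subset_insert heE heB
  by_cases hbD : b ∈ D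
  · exact ⟨e, heE, heB, D, hD, hDB, heD, hbD⟩
  obtain ⟨C', hC', hsub, hbC'⟩ := strong_elimination hC hD heC heD hbC hbD
  have hlt : C' \ B ⊂ C \ B := by
    refine (ssubset_iff_of_subset fun x hx ↦ ?_).2 ⟨e, mem_sdiff.2 ⟨heC, heB⟩, fun h ↦ ?_⟩
    · have := @hsub x
      have := @hDB x
      clear ih
      grind
    · exact notMem_erase e _ (hsub (mem_sdiff.1 h).1)
  exact ih _ (card_lt_card hlt) hC' hbC' rfl

theorem IsBase.exists_indep_insert_erase {B C : Finset α} {b : α} (hB : M.IsBase B)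
    (hb : b ∈ B) (hC : C ∈ M.circuits) (hbC : b ∈ C) :
    ∃ e ∉ B, M.Indep (insert e (B.erase b)) := by
  obtain ⟨e, heE, heB, D, hD, hDB, heD, hbD⟩ := hB.exists_fundamental_circuit hC hbC
  refine ⟨e, heB, insert_subset heE ((erase_subset b B).trans hB.1.1), fun D' hD' hD'B ↦ ?_⟩
  have hne : D ≠ D' := by grind
  have heD' : e ∈ D' := by
    by_contra h
    exact hB.1.2 D' hD' (by grind)
  obtain ⟨C', hC', hsub⟩ := M.elimination D hD D' hD' hne e (mem_inter.2 ⟨heD, heD'⟩)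
  exact hB.1.2 C' hC' (by grind)

end BingoMatroid

/-- a coloopless matroid of rank `r` has at least `binom(r+1,k)`
independent sets of cardinality `k`, for every `0 ≤ k ≤ r`. -/
theorem stmt17 {α : Type*} [DecidableEq α] (M : BingoMatroid α)
    (hcl : ∀ x ∈ M.E, ∃ C ∈ M.circuits, x ∈ C) (k : ℕ) (hk : k ≤ M.rank) :
    (Nat.choose (M.rank + 1) k : ℕ) ≤ Set.ncard {I : Finset α | M.Indep I ∧ I.card = k} := by
  obtain ⟨B, hB, hr⟩ := M.exists_isBase_card_eq_rank
  have hfin : {I : Finset α | M.Indep I ∧ I.card = k}.Finite :=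
    M.E.powerset.finite_toSet.subset fun I hI ↦ mem_coe.2 (mem_powerset.2 hI.1.1)
  rw [← hr] at hk ⊢
  cases k with
  | zero =>
    rw [Nat.choose_zero_right, Nat.one_le_iff_ne_zero, ← Nat.pos_iff_ne_zero, Set.ncard_pos hfin]
    exact ⟨∅, hB.1.mono (empty_subset B), card_empty⟩
  | succ k =>
    have hext : ∀ S ∈ powersetCard k B, ∃ e ∉ B, M.Indep (insert e S) := by
      intro S hS
      obtain ⟨hSB, hSk⟩ := mem_powersetCard.1 hS
      obtain ⟨b, hbB, hbS⟩ := exists_mem_notMem_of_card_lt_card (s := S) (t := B) (by omega)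
      obtain ⟨C, hC, hbC⟩ := hcl b (hB.1.1 hbB)
      obtain ⟨e, heB, he⟩ := hB.exists_indep_insert_erase hbB hC hbC
      exact ⟨e, heB, he.mono (insert_subset_insert e (subset_erase.2 ⟨hSB, hbS⟩))⟩
    obtain ⟨b, -⟩ := card_pos.1 (k.succ_pos.trans_le hk)
    have : Nonempty α := ⟨b⟩
    choose! g hgB hg using hext
    have hinj : Set.InjOn (fun S ↦ insert (g S) S) (powersetCard k B : Set (Finset α)) := by
      refine Set.LeftInvOn.injOn (f₁' := fun T ↦ T ∩ B) fun S hS ↦ ?_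
      have hSB := (mem_powersetCard.1 (mem_coe.1 hS)).1
      have hgS := hgB S (mem_coe.1 hS)
      grind
    have hdisj : Disjoint ((powersetCard k B).image fun S ↦ insert (g S) S)
        (powersetCard (k + 1) B) := by
      rw [Finset.disjoint_left]
      rintro T hT hTB
      obtain ⟨S, hS, rfl⟩ := mem_image.1 hT
      exact hgB S hS ((mem_powersetCard.1 hTB).1 (mem_insert_self _ _))
    rw [Nat.choose_succ_succ, ← card_powersetCard, ← card_powersetCard (k + 1) B,
      ← card_image_of_injOn hinj, ← card_union_of_disjoint hdisj, ← Set.ncard_coe_finset]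
    refine Set.ncard_le_ncard (fun T hT ↦ ?_) hfin
    rcases mem_union.1 (mem_coe.1 hT) with hT | hT
    · obtain ⟨S, hS, rfl⟩ := mem_image.1 hT
      obtain ⟨hSB, hSk⟩ := mem_powersetCard.1 hS
      exact ⟨hg S hS, by rw [card_insert_of_notMem fun h ↦ hgB S hS (hSB h), hSk]⟩
    · obtain ⟨hTB, hTk⟩ := mem_powersetCard.1 hT
      exact ⟨hB.1.mono hTB, hTk⟩
end
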